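/- arXiv:2508.09368 — 2 statements merged into one kernel-verified Lean document; each statement's English description precedes it below -/
import Mathlib

section
/- The set {(X,Y) ∈ SF × SF : X is linearly homeomorphic to Y} is an analytic subset of SF × SF. In particular, for every X ∈ SF the isomorphism class ⟨X⟩ = {Y ∈ SF : Y is linearly homeomorphic to X} is analytic. -/
open MeasureTheory Set Topology

noncomputable section

/-- `C(ℝ)`: continuous real-valued functions on `ℝ` with the compact-open topology,
which coincides with the topology of uniform convergence on compact subsets of `ℝ`. -/
abbrev CR : Type := C(ℝ, ℝ)

/-- `SF`: the set of closed linear subspaces of `C(ℝ)`. -/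
def SF : Set (Submodule ℝ CR) := {p | IsClosed (p : Set CR)}

/-- The Effros Borel structure on `SF`, generated by the sets
`{X ∈ SF : X ∩ U ≠ ∅}` for `U` open in `C(ℝ)`. -/
instance : MeasurableSpace SF :=
  MeasurableSpace.generateFrom
    {A : Set SF | ∃ U : Set CR, IsOpen U ∧
      A = {X : SF | (((X : Submodule ℝ CR) : Set CR) ∩ U).Nonempty}}

/-- A subset of a measurable space is analytic if it is the image of a Polish space
under a Borel map. -/
def IsAnalyticIn {α : Type*} [MeasurableSpace α] (A : Set α) : Prop :=
  ∃ (Z : Type) (tZ : TopologicalSpace Z), @PolishSpace Z tZ ∧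
    ∃ f : Z → α, @Measurable Z α (@borel Z tZ) _ f ∧ Set.range f = A

open Filter

section Extension

variable {D X Y : Type*} [AddCommGroup D] [Module ℝ D]
  [AddCommGroup X] [Module ℝ X] [UniformSpace X] [IsUniformAddGroup X]
  [ContinuousConstSMul ℝ X] [CompleteSpace X] [T0Space X]
  [AddCommGroup Y] [Module ℝ Y] [UniformSpace Y] [IsUniformAddGroup Y]
  [ContinuousConstSMul ℝ Y] [CompleteSpace Y] [T0Space Y]

/-- Two complete spaces that receive the same uniform space densely through linear maps are
isomorphic. -/
theorem nonempty_continuousLinearEquiv_of_isUniformInducing [UniformSpace D]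
    [IsUniformAddGroup D] (A : D →L[ℝ] X) (B : D →L[ℝ] Y)
    (hA : IsUniformInducing A) (hB : IsUniformInducing B)
    (dA : DenseRange A) (dB : DenseRange B) : Nonempty (X ≃L[ℝ] Y) := by
  refine ⟨ContinuousLinearEquiv.equivOfInverse (B.extend A) (A.extend B) ?_ ?_⟩
  · intro x
    refine dA.induction_on x (isClosed_eq ?_ continuous_id) fun d ↦ ?_
    · exact (A.extend B).continuous.comp (B.extend A).continuous
    · rw [B.extend_eq dA hA, A.extend_eq dB hB]
  · intro y
    refine dB.induction_on y (isClosed_eq ?_ continuous_id) fun d ↦ ?_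
    · exact (B.extend A).continuous.comp (A.extend B).continuous
    · rw [A.extend_eq dB hB, B.extend_eq dA hA]

theorem nonempty_continuousLinearEquiv_of_comap_eq (A : D →ₗ[ℝ] X) (B : D →ₗ[ℝ] Y)
    (h : comap A (𝓝 0) = comap B (𝓝 0)) (dA : DenseRange A) (dB : DenseRange B) :
    Nonempty (X ≃L[ℝ] Y) := by
  have hu : UniformSpace.comap A inferInstance = UniformSpace.comap B inferInstance := by
    refine IsUniformAddGroup.ext (IsUniformAddGroup.comap A) (IsUniformAddGroup.comap B) ?_
    have hA := @nhds_induced _ _ _ A 0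
    have hB := @nhds_induced _ _ _ B 0
    rw [map_zero] at hA hB
    exact hA.trans (h.trans hB.symm)
  let : UniformSpace D := UniformSpace.comap A inferInstance
  have : IsUniformAddGroup D := IsUniformAddGroup.comap A
  have hA : IsUniformInducing A := ⟨rfl⟩
  have hB : IsUniformInducing B := isUniformInducing_iff_uniformSpace.2 hu.symm
  exact nonempty_continuousLinearEquiv_of_isUniformInducing
    ⟨A, hA.uniformContinuous.continuous⟩ ⟨B, hB.uniformContinuous.continuous⟩ hA hB dA dB

end Extension

theorem linearCombination_coe {E : Type*} [AddCommGroup E] [Module ℝ E]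
    {X : Submodule ℝ E} (x : ℕ → X) (c : ℕ →₀ ℝ) :
    Finsupp.linearCombination ℝ (fun n ↦ (x n : E)) c = Finsupp.linearCombination ℝ x c := by
  simp [Finsupp.linearCombination_apply, Finsupp.sum]

theorem exists_denseRange_linearCombination {E : Type*} [AddCommGroup E] [Module ℝ E]
    [TopologicalSpace E] [SecondCountableTopology E] (X : Submodule ℝ E) :
    ∃ x : ℕ → X, DenseRange (Finsupp.linearCombination ℝ x) := by
  have : SecondCountableTopology X :=
    TopologicalSpace.Subtype.secondCountableTopology (X : Set E)
  refine ⟨TopologicalSpace.denseSeq X, (TopologicalSpace.denseRange_denseSeq X).mono ?_⟩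
  rintro _ ⟨n, rfl⟩
  exact ⟨Finsupp.single n 1, by simp⟩

section ClosedSpan

variable {E : Type*} [AddCommGroup E] [Module ℝ E] [UniformSpace E]

/-- `φ` witnesses, relative to a sequence `W` of neighbourhoods of zero, that the map
`y n ↦ x n` is well defined and continuous on the linear span of `y`. -/
def Dominates (W : ℕ → Set E) (x y : ℕ → E) (φ : ℕ → ℕ) : Prop :=
  ∀ k c, Finsupp.linearCombination ℝ y c ∈ interior (W (φ k)) →
    Finsupp.linearCombination ℝ x c ∈ closure (W k)

theorem exists_dominates_iff {W : ℕ → Set E} (hW : (𝓝 (0 : E)).HasBasis (fun _ ↦ True) W)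
    (x y : ℕ → E) : (∃ φ, Dominates W x y φ) ↔
      comap (Finsupp.linearCombination ℝ y) (𝓝 0) ≤
        comap (Finsupp.linearCombination ℝ x) (𝓝 0) := by
  rw [(hW.nhds_interior.comap _).le_basis_iff (hW.nhds_closure.comap _)]
  simp only [true_and, forall_const, Dominates]
  exact Classical.skolem (p := fun k m ↦ ∀ c, Finsupp.linearCombination ℝ y c ∈ interior (W m) →
    Finsupp.linearCombination ℝ x c ∈ closure (W k)).symm

variable [IsUniformAddGroup E] [ContinuousSMul ℝ E]

/-- The closed linear span of a sequence. -/
def closedSpan (x : ℕ → E) : Submodule ℝ E :=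
  (LinearMap.range (Finsupp.linearCombination ℝ x)).topologicalClosure

theorem isClosed_closedSpan (x : ℕ → E) : IsClosed (closedSpan x : Set E) :=
  Submodule.isClosed_topologicalClosure _

theorem continuous_linearCombination_left (c : ℕ →₀ ℝ) :
    Continuous fun x : ℕ → E ↦ Finsupp.linearCombination ℝ x c := by
  simp only [Finsupp.linearCombination_apply, Finsupp.sum]
  fun_prop

theorem isOpen_closedSpan_inter_nonempty {U : Set E} (hU : IsOpen U) :
    IsOpen {x : ℕ → E | ((closedSpan x : Set E) ∩ U).Nonempty} := by
  have : {x : ℕ → E | ((closedSpan x : Set E) ∩ U).Nonempty} =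
      ⋃ c : ℕ →₀ ℝ, {x | Finsupp.linearCombination ℝ x c ∈ U} := by
    ext x
    simp only [closedSpan, Submodule.topologicalClosure_coe, mem_ofPred_eq, mem_iUnion,
      closure_inter_open_nonempty_iff hU]
    constructor
    · rintro ⟨_, ⟨c, rfl⟩, hc⟩
      exact ⟨c, hc⟩
    · rintro ⟨c, hc⟩
      exact ⟨_, ⟨c, rfl⟩, hc⟩
  rw [this]
  exact isOpen_iUnion fun c ↦ hU.preimage (continuous_linearCombination_left c)

theorem closedSpan_coe_eq {X : Submodule ℝ E} (hX : IsClosed (X : Set E)) (x : ℕ → X)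
    (hx : DenseRange (Finsupp.linearCombination ℝ x)) :
    closedSpan (fun n ↦ (x n : E)) = X := by
  apply le_antisymm
  · refine Submodule.topologicalClosure_minimal _ ?_ hX
    rintro _ ⟨c, rfl⟩
    rw [linearCombination_coe]
    exact Subtype.coe_prop _
  · intro v hv
    have := image_closure_subset_closure_image (s := range (Finsupp.linearCombination ℝ x))
      (continuous_subtype_val (p := (· ∈ X))) ⟨⟨v, hv⟩, hx _, rfl⟩
    refine closure_mono ?_ this
    rintro _ ⟨_, ⟨c, rfl⟩, rfl⟩
    exact ⟨c, linearCombination_coe x c⟩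

theorem nonempty_closedSpan_equiv [CompleteSpace E] [T0Space E] (x y : ℕ → E)
    (h : comap (Finsupp.linearCombination ℝ x) (𝓝 0) =
      comap (Finsupp.linearCombination ℝ y) (𝓝 0)) :
    Nonempty (closedSpan x ≃L[ℝ] closedSpan y) := by
  have := (isClosed_closedSpan x).completeSpace_coe
  have := (isClosed_closedSpan y).completeSpace_coe
  have := (closedSpan x).toAddSubgroup.isUniformAddGroup
  have := (closedSpan y).toAddSubgroup.isUniformAddGroup
  have mem (z : ℕ → E) (c : ℕ →₀ ℝ) : Finsupp.linearCombination ℝ z c ∈ closedSpan z :=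
    Submodule.le_topologicalClosure _ ⟨c, rfl⟩
  have dense (z : ℕ → E) :
      DenseRange ((Finsupp.linearCombination ℝ z).codRestrict (closedSpan z) (mem z)) := by
    intro v
    rw [closure_subtype, ← range_comp]
    exact v.2
  refine nonempty_continuousLinearEquiv_of_comap_eq
    ((Finsupp.linearCombination ℝ x).codRestrict _ (mem x))
    ((Finsupp.linearCombination ℝ y).codRestrict _ (mem y)) ?_ (dense x) (dense y)
  rw [nhds_subtype, nhds_subtype, comap_comap, comap_comap]
  exact h

theorem isClosed_dominates {T : Type*} [TopologicalSpace T] (W : ℕ → Set E)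
    {x y : T → ℕ → E} {φ : T → ℕ → ℕ} (hx : Continuous x) (hy : Continuous y)
    (hφ : Continuous φ) : IsClosed {t | Dominates W (x t) (y t) (φ t)} := by
  have : {t | Dominates W (x t) (y t) (φ t)} = ⋂ (k : ℕ) (c : ℕ →₀ ℝ) (m : ℕ),
      {t | φ t k ∈ ({m}ᶜ : Set ℕ)} ∪
      ({t | Finsupp.linearCombination ℝ (y t) c ∈ (interior (W m))ᶜ} ∪
      {t | Finsupp.linearCombination ℝ (x t) c ∈ closure (W k)}) := by
    ext t
    simp only [Dominates, mem_ofPred_eq, mem_iInter, mem_union, mem_compl_iff, mem_singleton_iff]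
    refine forall_congr' fun k ↦ forall_congr' fun c ↦ ⟨?_, ?_⟩
    · intro h m
      by_cases hm : φ t k = m
      · subst hm
        tauto
      · exact Or.inl hm
    · intro h
      have := h (φ t k)
      tauto
  rw [this]
  refine isClosed_iInter fun k ↦ isClosed_iInter fun c ↦ isClosed_iInter fun m ↦ ?_
  refine IsClosed.union ?_ (IsClosed.union ?_ ?_)
  · exact (isClosed_discrete _).preimage ((continuous_apply k).comp hφ)
  · exact isOpen_interior.isClosed_compl.preimage
      ((continuous_linearCombination_left c).comp hy)
  · exact isClosed_closure.preimage ((continuous_linearCombination_left c).comp hx)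

/-- Pairs of sequences related by an isomorphism of closed spans, with witnesses of continuity
in both directions. -/
def isoCodes (W : ℕ → Set E) : Set ((ℕ → E) × (ℕ → E) × (ℕ → ℕ) × (ℕ → ℕ)) :=
  {z | Dominates W z.1 z.2.1 z.2.2.1 ∧ Dominates W z.2.1 z.1 z.2.2.2}

theorem isClosed_isoCodes (W : ℕ → Set E) : IsClosed (isoCodes W) :=
  (isClosed_dominates W (by fun_prop) (by fun_prop) (by fun_prop)).inter
    (isClosed_dominates W (by fun_prop) (by fun_prop) (by fun_prop))

theorem nonempty_equiv_of_mem_isoCodes [CompleteSpace E] [T0Space E] {W : ℕ → Set E}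
    (hW : (𝓝 (0 : E)).HasBasis (fun _ ↦ True) W)
    {z : (ℕ → E) × (ℕ → E) × (ℕ → ℕ) × (ℕ → ℕ)} (hz : z ∈ isoCodes W) :
    Nonempty (closedSpan z.1 ≃L[ℝ] closedSpan z.2.1) :=
  nonempty_closedSpan_equiv _ _ <| le_antisymm
    ((exists_dominates_iff hW _ _).1 ⟨_, hz.2⟩) ((exists_dominates_iff hW _ _).1 ⟨_, hz.1⟩)

theorem exists_mem_isoCodes {W : ℕ → Set E} (hW : (𝓝 (0 : E)).HasBasis (fun _ ↦ True) W)
    {X Y : Submodule ℝ E} (hY : IsClosed (Y : Set E)) (x : ℕ → X)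
    (hx : DenseRange (Finsupp.linearCombination ℝ x)) (e : X ≃L[ℝ] Y) :
    ∃ z ∈ isoCodes W, z.1 = (fun n ↦ (x n : E)) ∧ closedSpan z.2.1 = Y := by
  have hlc : ⇑(Finsupp.linearCombination ℝ fun n ↦ e (x n)) =
      e ∘ Finsupp.linearCombination ℝ x := by
    ext c
    simp [Finsupp.linearCombination_apply, Finsupp.sum]
  have comap_coe {V : Submodule ℝ E} (v : ℕ → V) :
      comap (Finsupp.linearCombination ℝ fun n ↦ (v n : E)) (𝓝 0) =
        comap (Finsupp.linearCombination ℝ v) (𝓝 0) := by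
    rw [nhds_subtype, comap_comap]
    congr 1
    ext c
    exact linearCombination_coe v c
  have he : comap e (𝓝 0) = 𝓝 0 := by
    have := e.toHomeomorph.isInducing.nhds_eq_comap 0
    simpa using this.symm
  have h : comap (Finsupp.linearCombination ℝ fun n ↦ (x n : E)) (𝓝 0) =
      comap (Finsupp.linearCombination ℝ fun n ↦ (e (x n) : E)) (𝓝 0) := by
    rw [comap_coe x, comap_coe fun n ↦ e (x n), hlc, ← comap_comap, he]
  obtain ⟨φ, hφ⟩ := (exists_dominates_iff hW _ _).2 h.ge
  obtain ⟨ψ, hψ⟩ := (exists_dominates_iff hW _ _).2 h.le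
  refine ⟨(_, _, φ, ψ), ⟨hφ, hψ⟩, rfl, closedSpan_coe_eq hY (fun n ↦ e (x n)) ?_⟩
  rw [hlc]
  exact e.surjective.denseRange.comp hx e.continuous

end ClosedSpan

instance ContinuousMap.isUniformAddGroup {α : Type*} [TopologicalSpace α] {β : Type*}
    [UniformSpace β] [AddGroup β] [IsUniformAddGroup β] : IsUniformAddGroup C(α, β) :=
  IsUniformInducing.isUniformAddGroup
    ({ toFun := ContinuousMap.toUniformOnFunIsCompact
       map_zero' := rfl
       map_add' := fun _ _ ↦ rfl } : C(α, β) →+ UniformOnFun α β {K | IsCompact K})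
    ContinuousMap.isUniformEmbedding_toUniformOnFunIsCompact.isUniformInducing

theorem measurable_closedSpan {Z : Type*} [TopologicalSpace Z] [MeasurableSpace Z]
    [BorelSpace Z] {x : Z → ℕ → CR} (hx : Continuous x) :
    Measurable fun z ↦ (⟨closedSpan (x z), isClosed_closedSpan _⟩ : SF) := by
  refine measurable_generateFrom ?_
  rintro _ ⟨U, hU, rfl⟩
  exact ((isOpen_closedSpan_inter_nonempty hU).preimage hx).measurableSet

theorem polishSpace_codes : PolishSpace ((ℕ → CR) × (ℕ → CR) × (ℕ → ℕ) × (ℕ → ℕ)) where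

/-- The isomorphism relation on `SF` is analytic, and so is every isomorphism class. -/
theorem isomorphism_analytic :
    IsAnalyticIn {p : SF × SF |
      Nonempty (↥(p.1 : Submodule ℝ CR) ≃L[ℝ] ↥(p.2 : Submodule ℝ CR))} ∧
    ∀ X : SF, IsAnalyticIn {Y : SF |
      Nonempty (↥(Y : Submodule ℝ CR) ≃L[ℝ] ↥(X : Submodule ℝ CR))} := by
  have := polishSpace_codes
  obtain ⟨W, hW⟩ := (𝓝 (0 : CR)).exists_antitone_basis
  replace hW := hW.toHasBasis
  constructor
  · refine ⟨↥(isoCodes W), inferInstance, (isClosed_isoCodes W).polishSpace,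
      fun z ↦ (⟨closedSpan z.1.1, isClosed_closedSpan _⟩,
        ⟨closedSpan z.1.2.1, isClosed_closedSpan _⟩), ?_, ?_⟩
    · borelize ↥(isoCodes W)
      exact (measurable_closedSpan (by fun_prop)).prodMk (measurable_closedSpan (by fun_prop))
    · ext ⟨⟨X, hX⟩, ⟨Y, hY⟩⟩
      constructor
      · rintro ⟨z, hz⟩
        rw [← hz]
        exact nonempty_equiv_of_mem_isoCodes hW z.2
      · rintro ⟨e⟩
        obtain ⟨x, hx⟩ := exists_denseRange_linearCombination X
        obtain ⟨z, hz, hzx, hzY⟩ := exists_mem_isoCodes hW hY x hx e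
        refine ⟨⟨z, hz⟩, Prod.ext (Subtype.ext ?_) (Subtype.ext hzY)⟩
        change closedSpan z.1 = X
        rw [hzx]
        exact closedSpan_coe_eq hX x hx
  · rintro ⟨X, hX⟩
    obtain ⟨x, hx⟩ := exists_denseRange_linearCombination X
    let C : Set ((ℕ → CR) × (ℕ → CR) × (ℕ → ℕ) × (ℕ → ℕ)) :=
      isoCodes W ∩ {z | z.1 = fun n ↦ (x n : CR)}
    have hC : IsClosed C :=
      (isClosed_isoCodes W).inter (isClosed_eq continuous_fst continuous_const)
    refine ⟨↥C, inferInstance, hC.polishSpace,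
      fun z ↦ ⟨closedSpan z.1.2.1, isClosed_closedSpan _⟩, ?_, ?_⟩
    · borelize ↥C
      exact measurable_closedSpan (by fun_prop)
    · ext ⟨Y, hY⟩
      constructor
      · rintro ⟨⟨z, hz, hzx⟩, hzY⟩
        obtain ⟨e⟩ := nonempty_equiv_of_mem_isoCodes hW hz
        have hzX : closedSpan z.1 = X := by
          rw [show z.1 = _ from hzx]
          exact closedSpan_coe_eq hX x hx
        obtain rfl : closedSpan z.2.1 = Y := congrArg Subtype.val hzY
        subst hzX
        exact ⟨e.symm⟩
      · rintro ⟨e⟩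
        obtain ⟨z, hz, hzx, hzY⟩ := exists_mem_isoCodes hW hY x hx e.symm
        exact ⟨⟨z, hz, hzx⟩, Subtype.ext hzY⟩
end
end

section
/- The set Nuc = {X ∈ SF : X is a nuclear space} is a Borel subset of SF. -/
open MeasureTheory Set Topology

noncomputable section

/-- `X ∈ SF` is nuclear (via Grothendieck's characterization): for any increasing sequence
of seminorms generating the topology, every unconditionally convergent series is
absolutely convergent. -/
def IsNuclear (X : SF) : Prop :=
  ∀ p : ℕ → Seminorm ℝ ↥(X : Submodule ℝ CR), Monotone p → WithSeminorms p →
    ∀ x : ℕ → ↥(X : Submodule ℝ CR), Summable x →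
      ∀ n : ℕ, Summable fun j => p n (x j)

open Filter

/-- A family of points of `X` lying in an open subset of a countable power of `C(ℝ)` can be
detected by countably many conditions `X ∩ U ≠ ∅`. -/
theorem measurableSet_exists_mem_of_isOpen_pi {ι : Type*} [Countable ι] {U : Set (ι → CR)}
    (hU : IsOpen U) :
    MeasurableSet {X : SF | ∃ x ∈ U, ∀ i, x i ∈ (X : Submodule ℝ CR)} := by
  classical
  let B := TopologicalSpace.countableBasis CR
  have hB : TopologicalSpace.IsTopologicalBasis B := TopologicalSpace.isBasis_countableBasis CR
  have : Countable B := (TopologicalSpace.countable_countableBasis CR).to_subtype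
  have key : {X : SF | ∃ x ∈ U, ∀ i, x i ∈ (X : Submodule ℝ CR)} =
      ⋃ (I : Finset ι) (b : I → B) (_ : {x : ι → CR | ∀ i : I, x i ∈ (b i : Set CR)} ⊆ U),
        ⋂ i : I, {X : SF | (((X : Submodule ℝ CR) : Set CR) ∩ (b i : Set CR)).Nonempty} := by
    ext X
    simp only [mem_ofPred_eq, mem_iUnion, mem_iInter, exists_prop]
    constructor
    · rintro ⟨x, hxU, hxX⟩
      obtain ⟨I, u, hu, hsub⟩ := isOpen_pi_iff.1 hU x hxU
      have hb : ∀ i : I, ∃ b : B, x i ∈ (b : Set CR) ∧ (b : Set CR) ⊆ u i := fun i => by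
        obtain ⟨b, hb, h1, h2⟩ := hB.exists_subset_of_mem_open (hu i i.2).2 (hu i i.2).1
        exact ⟨⟨b, hb⟩, h1, h2⟩
      choose b hxb hbu using hb
      refine ⟨I, b, fun y hy => hsub fun i hi => hbu ⟨i, hi⟩ (hy ⟨i, hi⟩),
        fun i => ⟨x i, hxX i, hxb i⟩⟩
    · rintro ⟨I, b, hsub, hne⟩
      choose y hyX hyb using hne
      refine ⟨fun i => if h : i ∈ I then y ⟨i, h⟩ else 0, hsub fun i => ?_, fun i => ?_⟩
      · simpa using hyb i
      · dsimp only
        split_ifs with h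
        · exact hyX ⟨i, h⟩
        · exact zero_mem _
  rw [key]
  refine MeasurableSet.iUnion fun I => MeasurableSet.iUnion fun b => MeasurableSet.iUnion fun _ =>
    MeasurableSet.iInter fun i => MeasurableSpace.measurableSet_generateFrom
      ⟨b i, hB.isOpen (b i).2, rfl⟩

/-- The seminorm `f ↦ sup_{|t| ≤ n} |f t|` on `C(ℝ)`. -/
def supSeminorm (n : ℕ) : Seminorm ℝ CR :=
  (normSeminorm ℝ C(Icc (-(n : ℝ)) n, ℝ)).comp
    (ContinuousMap.compCLM ℝ ℝ
      (⟨Subtype.val, continuous_subtype_val⟩ : C(Icc (-(n : ℝ)) n, ℝ))).toLinearMap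

theorem supSeminorm_apply (n : ℕ) (f : CR) :
    supSeminorm n f = ‖f.comp (⟨Subtype.val, continuous_subtype_val⟩ : C(Icc (-(n : ℝ)) n, ℝ))‖ :=
  rfl

theorem supSeminorm_le_iff {n : ℕ} {f : CR} {r : ℝ} (hr : 0 ≤ r) :
    supSeminorm n f ≤ r ↔ ∀ t ∈ Icc (-(n : ℝ)) n, |f t| ≤ r := by
  rw [supSeminorm_apply, ContinuousMap.norm_le _ hr]
  simp

theorem continuous_supSeminorm (n : ℕ) : Continuous (supSeminorm n) :=
  (continuous_norm (E := C(Icc (-(n : ℝ)) n, ℝ))).comp (ContinuousMap.continuous_precomp _)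

theorem monotone_supSeminorm : Monotone supSeminorm := by
  intro m n hmn f
  have hmn' : (m : ℝ) ≤ n := by exact_mod_cast hmn
  refine (supSeminorm_le_iff (apply_nonneg _ _)).2 fun t ht => ?_
  exact (supSeminorm_le_iff (apply_nonneg _ _)).1 le_rfl t ⟨by linarith [ht.1], ht.2.trans hmn'⟩

theorem withSeminorms_supSeminorm : WithSeminorms supSeminorm := by
  rw [SeminormFamily.withSeminorms_iff_nhds_eq_iInf]
  refine le_antisymm (le_iInf fun n => ?_) ?_
  · simpa using ((continuous_supSeminorm n).tendsto 0).le_comap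
  · change Tendsto id _ _
    rw [ContinuousMap.tendsto_iff_forall_isCompact_tendstoUniformlyOn]
    intro K hK
    rw [Metric.tendstoUniformlyOn_iff]
    intro ε hε
    obtain ⟨r, hr⟩ := hK.isBounded.subset_closedBall 0
    obtain ⟨n, hn⟩ := exists_nat_ge r
    have h : ∀ᶠ f in ⨅ i, comap (supSeminorm i) (𝓝 0), supSeminorm n f < ε :=
      mem_iInf_of_mem n (preimage_mem_comap (Iio_mem_nhds hε))
    filter_upwards [h] with f hf t ht
    have ht' := hr ht
    rw [mem_closedBall_zero_iff, Real.norm_eq_abs] at ht'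
    have := (supSeminorm_le_iff (apply_nonneg _ _)).1 (le_refl (supSeminorm n f)) t
      (abs_le.1 (ht'.trans hn))
    simpa [Real.dist_eq] using this.trans_lt hf

section Grothendieck

variable {E : Type*} [AddCommGroup E] [Module ℝ E]

/-- Every identity map `(E, q n) → (E, q k)`, for suitable `n` depending on `k`, is absolutely
summing. -/
def IsAbsolutelySumming (q : ℕ → Seminorm ℝ E) : Prop :=
  ∀ k, ∃ n C : ℕ, ∀ (F : Finset ℕ) (x : ℕ → E),
    ∃ G ⊆ F, ∑ j ∈ F, q k (x j) ≤ C * q n (∑ j ∈ G, x j)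

variable [TopologicalSpace E]

theorem WithSeminorms.exists_le_nat_mul {q : ℕ → Seminorm ℝ E} (hq : WithSeminorms q)
    (hmono : Monotone q) {p : Seminorm ℝ E} (hp : Continuous p) :
    ∃ k C : ℕ, ∀ x, p x ≤ C * q k x := by
  obtain ⟨s, C, -, h⟩ := Seminorm.bound_of_continuous hq p hp
  obtain ⟨C', hC'⟩ := exists_nat_ge (C : ℝ)
  refine ⟨s.sup id, C', fun x => (h x).trans ?_⟩
  have h1 : s.sup q ≤ q (s.sup id) := Finset.sup_le fun i hi => hmono (Finset.le_sup (f := id) hi)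
  calc (C : ℝ) * (s.sup q) x ≤ C * q (s.sup id) x := by gcongr; exact h1 x
    _ ≤ C' * q (s.sup id) x := by gcongr

theorem IsAbsolutelySumming.summable {q : ℕ → Seminorm ℝ E} (h : IsAbsolutelySumming q)
    (hq : WithSeminorms q) {x : ℕ → E} (hx : Summable x) (k : ℕ) :
    Summable fun j => q k (x j) := by
  classical
  have := hq.topologicalAddGroup
  let _ : UniformSpace E := IsTopologicalAddGroup.rightUniformSpace E
  have : IsUniformAddGroup E := isUniformAddGroup_of_addCommGroup
  obtain ⟨n, C, hC⟩ := h k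
  obtain ⟨s, hs⟩ := cauchySeq_finset_iff_sum_vanishing.1 hx.hasSum.cauchySeq
    ((q n).ball 0 1) ((q n).ball_mem_nhds (hq.continuous_seminorm n) one_pos)
  refine summable_of_sum_le (c := ∑ j ∈ s, q k (x j) + C) (fun j => apply_nonneg _ _) fun u => ?_
  obtain ⟨G, hG, hle⟩ := hC (u \ s) x
  have hG1 : q n (∑ j ∈ G, x j) < 1 := by
    simpa [Seminorm.mem_ball] using
      hs G (Finset.disjoint_of_subset_left hG Finset.sdiff_disjoint)
  have h1 : ∑ j ∈ u \ s, q k (x j) ≤ C :=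
    hle.trans (mul_le_of_le_one_right (Nat.cast_nonneg _) hG1.le)
  have h2 : ∑ j ∈ u, q k (x j) ≤ ∑ j ∈ s ∪ u \ s, q k (x j) :=
    Finset.sum_le_sum_of_subset_of_nonneg (by simp) fun _ _ _ => apply_nonneg _ _
  rw [Finset.sum_union Finset.disjoint_sdiff] at h2
  linarith

end Grothendieck

theorem isAbsolutelySumming_of_forall_summable {E : Type*} [AddCommGroup E] [Module ℝ E]
    [UniformSpace E] [IsUniformAddGroup E] [CompleteSpace E] {q : ℕ → Seminorm ℝ E}
    (hq : WithSeminorms q) (hmono : Monotone q)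
    (h : ∀ x : ℕ → E, Summable x → ∀ n, Summable fun j => q n (x j)) :
    IsAbsolutelySumming q := by
  classical
  by_contra hcon
  unfold IsAbsolutelySumming at hcon
  push Not at hcon
  obtain ⟨k, hk⟩ := hcon
  have hnorm : ∀ n : ℕ, ∃ (F : Finset ℕ) (x : ℕ → E), (∑ j ∈ F, q k (x j) = 1) ∧
      ∀ G ⊆ F, q n (∑ j ∈ G, x j) ≤ (1 / 2) ^ n := by
    intro n
    obtain ⟨F, x, hx⟩ := hk n (2 ^ n)
    set S := ∑ j ∈ F, q k (x j)
    have hSpos : 0 < S := lt_of_le_of_lt (by positivity) (hx ∅ (Finset.empty_subset _))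
    refine ⟨F, fun j => S⁻¹ • x j, ?_, fun G hG => ?_⟩
    · simp only [map_smul_eq_mul, ← Finset.mul_sum, norm_inv, Real.norm_of_nonneg hSpos.le]
      exact inv_mul_cancel₀ hSpos.ne'
    · rw [← Finset.smul_sum, map_smul_eq_mul, norm_inv, Real.norm_of_nonneg hSpos.le]
      have := hx G hG
      push_cast at this
      rw [inv_mul_le_iff₀ hSpos, one_div, inv_pow, ← div_eq_mul_inv, le_div_iff₀ (by positivity)]
      linarith
  choose F x hsum hsmall using hnorm
  let y : ℕ × ℕ → E := fun p => if p.2 ∈ F p.1 then x p.1 p.2 else 0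
  have hrow : ∀ (t : Finset (ℕ × ℕ)) (m : ℕ),
      ∑ p ∈ t with p.1 = m, y p =
        ∑ j ∈ (F m).filter (fun j => (m, j) ∈ t), x m j := by
    intro t m
    symm
    have : ∑ p ∈ t with p.1 = m, y p = ∑ p ∈ (t.filter (fun p => p.1 = m)).filter
        (fun p => p.2 ∈ F p.1), x p.1 p.2 := by rw [Finset.sum_filter _ (s := t.filter _)]
    rw [this]
    refine Finset.sum_bij (fun j _ => (m, j)) ?_ ?_ ?_ ?_
    · intro j hj; simp at hj ⊢; tauto
    · intro a _ b _ hab; simpa using hab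
    · rintro ⟨a, b⟩ hb
      simp only [Finset.mem_filter] at hb
      obtain ⟨⟨h1, rfl⟩, h2⟩ := hb
      exact ⟨b, by simp [h1, h2], rfl⟩
    · intro j _; rfl
  have hysum : Summable y := by
    rw [summable_iff_cauchySeq_finset, cauchySeq_finset_iff_sum_vanishing]
    intro e he
    obtain ⟨⟨s, r⟩, hr, hsr⟩ := hq.hasBasis_zero_ball.mem_iff.1 he
    simp only at hr hsr
    have hsup : s.sup q ≤ q (s.sup id) :=
      Finset.sup_le fun i hi => hmono (Finset.le_sup (f := id) hi)
    obtain ⟨s0, hs0⟩ := summable_iff_vanishing_norm.1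
      (summable_geometric_of_lt_one (by norm_num : (0 : ℝ) ≤ 1 / 2) (by norm_num)) r hr
    let T : Finset ℕ := s0 ∪ Finset.range (s.sup id)
    refine ⟨T.biUnion fun m => (F m).image fun j => (m, j), fun t ht => hsr ?_⟩
    rw [Seminorm.mem_ball, sub_zero]
    refine (hsup _).trans_lt ?_
    rw [← Finset.sum_fiberwise_of_maps_to (t := t.image Prod.fst)
      (fun p hp => Finset.mem_image_of_mem _ hp)]
    have hterm : ∀ m ∈ t.image Prod.fst, m ∈ T → ∑ p ∈ t with p.1 = m, y p = 0 := by
      intro m _ hmT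
      rw [hrow, Finset.filter_eq_empty_iff.2, Finset.sum_empty]
      intro j hj hjt
      exact Finset.disjoint_left.1 ht hjt
        (Finset.mem_biUnion.2 ⟨m, hmT, Finset.mem_image_of_mem _ hj⟩)
    have hsplit : ∑ m ∈ t.image Prod.fst, ∑ p ∈ t with p.1 = m, y p =
        ∑ m ∈ t.image Prod.fst \ T, ∑ p ∈ t with p.1 = m, y p := by
      symm
      refine Finset.sum_subset Finset.sdiff_subset fun m hm hm' => hterm m hm ?_
      by_contra hmT
      exact hm' (Finset.mem_sdiff.2 ⟨hm, hmT⟩)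
    rw [hsplit]
    calc q (s.sup id) (∑ m ∈ t.image Prod.fst \ T, ∑ p ∈ t with p.1 = m, y p)
        ≤ ∑ m ∈ t.image Prod.fst \ T, q (s.sup id) (∑ p ∈ t with p.1 = m, y p) :=
          Finset.le_sum_of_subadditive _ (map_zero _).le (map_add_le_add _) _ _
      _ ≤ ∑ m ∈ t.image Prod.fst \ T, (1 / 2 : ℝ) ^ m := by
          refine Finset.sum_le_sum fun m hm => ?_
          have hm' : s.sup id ≤ m := by
            by_contra hlt
            exact (Finset.mem_sdiff.1 hm).2
              (Finset.mem_union_right _ (Finset.mem_range.2 (not_le.1 hlt)))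
          rw [hrow]
          exact (hmono hm' _).trans (hsmall m _ (Finset.filter_subset _ _))
      _ < r := (le_abs_self _).trans_lt (hs0 _ (Finset.disjoint_of_subset_right
          Finset.subset_union_left Finset.sdiff_disjoint))
  have habs : Summable fun p => q k (y p) := by
    have := h (y ∘ Nat.pairEquiv.symm) (Nat.pairEquiv.symm.summable_iff.2 hysum) k
    exact Nat.pairEquiv.symm.summable_iff.1 this
  have hone : ∀ N : ℕ, (N : ℝ) ≤ ∑' p, q k (y p) := by
    intro N
    have h1 := habs.sum_le_tsum ((Finset.range N).sigma F |>.map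
      (Equiv.sigmaEquivProd ℕ ℕ).toEmbedding) fun p _ => apply_nonneg _ _
    rw [Finset.sum_map, Finset.sum_sigma] at h1
    refine le_trans (le_of_eq ?_) h1
    rw [show (N : ℝ) = ∑ m ∈ Finset.range N, (1 : ℝ) by simp]
    refine Finset.sum_congr rfl fun m _ => ?_
    rw [← hsum m]
    refine Finset.sum_congr rfl fun j hj => ?_
    simp [y, hj]
  obtain ⟨N, hN⟩ := exists_nat_gt (∑' p, q k (y p))
  exact absurd (hone N) (not_le.2 hN)

theorem isUniformAddGroup_CR : IsUniformAddGroup CR :=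
  ContinuousMap.isUniformEmbedding_toUniformOnFunIsCompact.isUniformInducing.isUniformAddGroup
    (⟨⟨ContinuousMap.toUniformOnFunIsCompact, rfl⟩, fun _ _ => rfl⟩ : CR →+ _)

theorem isNuclear_iff_isAbsolutelySumming (X : SF) :
    IsNuclear X ↔
      IsAbsolutelySumming fun n => (supSeminorm n).comp (X : Submodule ℝ CR).subtype := by
  have hq : WithSeminorms fun n => (supSeminorm n).comp (X : Submodule ℝ CR).subtype :=
    Topology.IsInducing.withSeminorms withSeminorms_supSeminorm
      (f := (X : Submodule ℝ CR).subtype) Topology.IsInducing.subtypeVal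
  have hmono : Monotone fun n => (supSeminorm n).comp (X : Submodule ℝ CR).subtype :=
    fun m n hmn x => monotone_supSeminorm hmn x
  have : CompleteSpace (X : Submodule ℝ CR) := IsClosed.completeSpace_coe (hs := X.2)
  have := isUniformAddGroup_CR
  have : IsUniformAddGroup (X : Submodule ℝ CR) :=
    (X : Submodule ℝ CR).toAddSubgroup.isUniformAddGroup
  constructor
  · intro h
    exact isAbsolutelySumming_of_forall_summable hq hmono (h _ hmono hq)
  · intro h p _ hp x hx n
    obtain ⟨k, C, hC⟩ := hq.exists_le_nat_mul hmono (hp.continuous_seminorm n)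
    exact Summable.of_nonneg_of_le (fun _ => apply_nonneg _ _) (fun j => hC (x j))
      ((h.summable hq hx k).mul_left _)

/-- `Nuc = {X ∈ SF : X is nuclear}` is Borel in `SF`. -/
theorem nuclear_borel : MeasurableSet {X : SF | IsNuclear X} := by
  have key : {X : SF | IsNuclear X} = ⋂ k : ℕ, ⋃ (n : ℕ) (C : ℕ), ⋂ F : Finset ℕ,
      {X : SF | ∃ x ∈ {x : ℕ → CR | ∀ G ∈ F.powerset,
        C * supSeminorm n (∑ j ∈ G, x j) < ∑ j ∈ F, supSeminorm k (x j)},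
        ∀ i, x i ∈ (X : Submodule ℝ CR)}ᶜ := by
    ext X
    simp only [mem_ofPred_eq, isNuclear_iff_isAbsolutelySumming, IsAbsolutelySumming, mem_iInter,
      mem_iUnion, mem_compl_iff, Finset.mem_powerset]
    refine forall_congr' fun k => exists_congr fun n => exists_congr fun C =>
      forall_congr' fun F => ?_
    push Not
    constructor
    · intro h x hx
      by_contra! hX
      obtain ⟨G, hG, hle⟩ := h fun i => ⟨x i, hX i⟩
      refine absurd (hx G hG) (not_lt.2 ?_)
      simpa using hle
    · intro h x
      by_contra! hX
      obtain ⟨i, hi⟩ := h (fun i => x i) fun G hG => by simpa using hX G hG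
      exact hi (x i).2
  rw [key]
  refine MeasurableSet.iInter fun k => MeasurableSet.iUnion fun n => MeasurableSet.iUnion fun C =>
    MeasurableSet.iInter fun F => (measurableSet_exists_mem_of_isOpen_pi ?_).compl
  have hopen : ∀ G : Finset ℕ, IsOpen {x : ℕ → CR |
      C * supSeminorm n (∑ j ∈ G, x j) < ∑ j ∈ F, supSeminorm k (x j)} := fun G =>
    isOpen_lt
      (continuous_const.mul ((continuous_supSeminorm n).comp
        (continuous_finsetSum _ fun j _ => continuous_apply j)))
      (continuous_finsetSum _ fun j _ => (continuous_supSeminorm k).comp (continuous_apply j))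
  simp only [ofPred_forall]
  exact isOpen_biInter_finset fun G _ => hopen G
end
end
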